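/- For any real c > 0 and any integers T, t with 0 ≤ T < t, the expected fraction of time that Z exceeds c satisfies (1/t) Σ_{τ=0}^{t−1} P[Z(τ) > c] ≤ (e^{r δ_max} − ρ) e^{−rc}/(1 − ρ) + T/t + e^{r(z₀ − c)} ρ^T / (t(1 − ρ)). -/

import Mathlib

open MeasureTheory

/-- A quadratic upper bound for `exp` on `[-y, y]`, of the kind used for Bernstein's inequality. -/
lemma exp_le_one_add_add_of_abs_le {x y B : ℝ} (hxy : |x| ≤ y) (hy : y ≤ 1)
    (hB : B * (1 - y / 3) = y ^ 2 / 2) : Real.exp x ≤ 1 + x + B := by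
  have hy0 : 0 ≤ y := (abs_nonneg x).trans hxy
  have h := Real.exp_bound (hxy.trans hy) (n := 4) (by norm_num)
  simp only [Finset.sum_range_succ, Finset.sum_range_zero, Nat.factorial] at h
  have h' := (abs_le.1 h).2
  push_cast at h'
  have h2 : x ^ 2 ≤ y ^ 2 := sq_le_sq' (abs_le.1 hxy).1 (abs_le.1 hxy).2
  have h3 : x ^ 3 ≤ y ^ 3 := by
    calc x ^ 3 ≤ |x ^ 3| := le_abs_self _
      _ = |x| ^ 3 := abs_pow x 3
      _ ≤ y ^ 3 := by gcongr
  have h4 : |x| ^ 4 ≤ y ^ 4 := by gcongr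
  have h4' : 0 ≤ y ^ 4 := by positivity
  have hBy : y ^ 2 / 2 + y ^ 3 / 6 + y ^ 4 / 18 ≤ B := by
    have hpos : 0 < 1 - y / 3 := by linarith
    refine le_of_mul_le_mul_right ?_ hpos
    have h5 : 0 ≤ y ^ 5 := by positivity
    rw [hB]
    nlinarith
  norm_num at h'
  linarith

/-- A nonnegative weight which is measurable with respect to the past and vanishes off `s`
preserves a conditional drift bound valid on `s`. -/
lemma integral_mul_le_of_condExp_le {Ω : Type*} {m m0 : MeasurableSpace Ω} (hm : m ≤ m0)
    (P : Measure[m0] Ω) [IsProbabilityMeasure P] {W D : Ω → ℝ} {s : Set Ω} {b : ℝ}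
    (hW : StronglyMeasurable[m] W) (hW0 : ∀ x, 0 ≤ W x) (hWs : ∀ x, x ∉ s → W x = 0)
    (hWi : Integrable W P) (hD : Integrable D P) (hWD : Integrable (fun x => W x * D x) P)
    (hs : ∀ᵐ x ∂P, x ∈ s → (P[D | m]) x ≤ b) :
    ∫ x, W x * D x ∂P ≤ b * ∫ x, W x ∂P := by
  have hpull : P[fun x => W x * D x | m] =ᵐ[P] fun x => W x * (P[D | m]) x :=
    condExp_mul_of_stronglyMeasurable_left hW hWD hD
  rw [← integral_condExp hm, ← integral_const_mul]
  refine integral_mono_ae integrable_condExp (hWi.const_mul b) ?_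
  filter_upwards [hpull, hs] with x hx hxs
  rw [hx]
  by_cases h : x ∈ s
  · rw [mul_comm b]
    exact mul_le_mul_of_nonneg_left (hxs h) (hW0 x)
  · simp [hWs x h]

/-- Exponential moments of a process which has bounded increments and negative drift while
positive satisfy an affine contraction. -/
lemma integral_exp_succ_le {Ω : Type*} {m m0 : MeasurableSpace Ω} (hm : m ≤ m0)
    (P : Measure[m0] Ω) [IsProbabilityMeasure P] {X Y : Ω → ℝ} {δ β r : ℝ}
    (hXm : Measurable[m] X) (hY : Measurable[m0] Y) (hr : 0 ≤ r)
    (hXi : Integrable (fun x => Real.exp (r * X x)) P)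
    (hYi : Integrable (fun x => Real.exp (r * Y x)) P)
    (hbdd : ∀ᵐ x ∂P, |Y x - X x| ≤ δ)
    (hdrift : ∀ᵐ x ∂P, 0 < X x → (P[fun y => Y y - X y | m]) x ≤ -β)
    (hexp : ∀ d, |d| ≤ δ → Real.exp (r * d) ≤ 1 + r * d + r * β / 2) (hδ : 0 ≤ δ) :
    ∫ x, Real.exp (r * Y x) ∂P ≤
      (1 - r * β / 2) * ∫ x, Real.exp (r * X x) ∂P +
        (Real.exp (r * δ) - (1 - r * β / 2)) := by
  have hX : Measurable[m0] X := hXm.mono hm le_rfl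
  have hβ0 : 0 ≤ r * β / 2 := by simpa using hexp 0 (by simpa using hδ)
  set s : Set Ω := {x | 0 < X x}
  have hsm : MeasurableSet[m] s := hXm measurableSet_Ioi
  set W : Ω → ℝ := s.indicator fun x => Real.exp (r * X x)
  have hWm : Measurable[m] W := (Real.measurable_exp.comp (hXm.const_mul r)).indicator hsm
  have hWi : Integrable W P := hXi.indicator (hm _ hsm)
  have hDi : Integrable (fun x => Y x - X x) P :=
    Integrable.of_bound (hY.sub hX).aestronglyMeasurable δ hbdd
  have hWD : Integrable (fun x => W x * (Y x - X x)) P :=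
    hWi.mul_bdd (c := δ) (hY.sub hX).aestronglyMeasurable hbdd
  have hW0 : ∀ x, 0 ≤ W x := fun x => Set.indicator_nonneg (fun _ _ => (Real.exp_pos _).le) x
  have hkey := integral_mul_le_of_condExp_le hm P (s := s) hWm.stronglyMeasurable hW0
    (fun x hx => Set.indicator_of_notMem hx _) hWi hDi hWD hdrift
  have hρX := hXi.const_mul (1 - r * β / 2)
  have hWβ := hWi.const_mul (r * β)
  have hWr := hWD.const_mul r
  have hpt : ∀ᵐ x ∂P, Real.exp (r * Y x) ≤
      (1 - r * β / 2) * Real.exp (r * X x) + r * β * W x + r * (W x * (Y x - X x)) +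
        (Real.exp (r * δ) - (1 - r * β / 2)) := by
    filter_upwards [hbdd] with x hx
    have hsplit : Real.exp (r * Y x) = Real.exp (r * X x) * Real.exp (r * (Y x - X x)) := by
      rw [← Real.exp_add]; ring_nf
    have hδ1 : 1 ≤ Real.exp (r * δ) := Real.one_le_exp (mul_nonneg hr hδ)
    by_cases hxs : x ∈ s
    · have hWx : W x = Real.exp (r * X x) := Set.indicator_of_mem hxs _
      rw [hWx, hsplit]
      have := mul_le_mul_of_nonneg_left (hexp _ hx) (Real.exp_pos (r * X x)).le
      linarith
    · have hWx : W x = 0 := Set.indicator_of_notMem hxs _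
      have hX0 : X x ≤ 0 := not_lt.1 hxs
      have h1 : Real.exp (r * X x) ≤ 1 :=
        Real.exp_le_one_iff.2 (mul_nonpos_of_nonneg_of_nonpos hr hX0)
      have h2 : Real.exp (r * (Y x - X x)) ≤ Real.exp (r * δ) :=
        Real.exp_le_exp.2 (mul_le_mul_of_nonneg_left (abs_le.1 hx).2 hr)
      rw [hWx, hsplit]
      have h3 := mul_le_mul_of_nonneg_left h2 (Real.exp_pos (r * X x)).le
      nlinarith
  have hsum₂ : Integrable (fun x => (1 - r * β / 2) * Real.exp (r * X x) + r * β * W x) P :=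
    hρX.add hWβ
  have hsum₃ : Integrable (fun x => (1 - r * β / 2) * Real.exp (r * X x) + r * β * W x +
      r * (W x * (Y x - X x))) P := hsum₂.add hWr
  have hint := integral_mono_ae hYi
    (hsum₃.add (integrable_const (Real.exp (r * δ) - (1 - r * β / 2)))) hpt
  simp only [Pi.add_apply] at hint
  rw [integral_add hsum₃ (integrable_const _), integral_add hsum₂ hWr, integral_add hρX hWβ,
    integral_const_mul, integral_const_mul, integral_const_mul] at hint
  simp only [integral_const, probReal_univ, one_smul] at hint
  have := mul_le_mul_of_nonneg_left hkey hr
  linarith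

/-- Iterating an affine contraction. -/
lemma le_of_affine_contraction {V : ℕ → ℝ} {ρ K : ℝ} (hρ0 : 0 ≤ ρ) (hρ1 : ρ < 1) (hK : 0 ≤ K)
    (hV : ∀ n, V (n + 1) ≤ ρ * V n + K) (n : ℕ) : V n ≤ K / (1 - ρ) + V 0 * ρ ^ n := by
  have h1 : 0 < 1 - ρ := by linarith
  induction n with
  | zero => have := div_nonneg hK h1.le; simpa using this
  | succ n ih =>
    have h2 : K = K / (1 - ρ) * (1 - ρ) := by field_simp
    have h3 := mul_le_mul_of_nonneg_left ih hρ0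
    have h4 := hV n
    rw [pow_succ]
    linarith

/-- A sequence bounded by one, and by a constant plus a geometric term, has averages bounded by
the constant, the fraction of terms discarded, and a geometric tail. -/
lemma average_le_of_le_geometric {p : ℕ → ℝ} {A G ρ : ℝ} (hA : 0 ≤ A) (hG : 0 ≤ G)
    (hρ0 : 0 ≤ ρ) (hρ1 : ρ < 1) (hp1 : ∀ n, p n ≤ 1) (hp : ∀ n, p n ≤ A + G * ρ ^ n)
    {T t : ℕ} (hT : T < t) :
    (1 / (t : ℝ)) * ∑ n ∈ Finset.range t, p n ≤ A + (T : ℝ) / t + G * ρ ^ T / (t * (1 - ρ)) := by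
  have h1 : 0 < 1 - ρ := by linarith
  have ht : (0 : ℝ) < t := by exact_mod_cast (Nat.zero_le T).trans_lt hT
  have hhead : ∑ n ∈ Finset.range T, p n ≤ T := by
    simpa using Finset.sum_le_sum (s := Finset.range T) fun n _ => hp1 n
  have htail : ∑ n ∈ Finset.Ico T t, p n ≤ t * A + G * (ρ ^ T / (1 - ρ)) := by
    calc ∑ n ∈ Finset.Ico T t, p n ≤ ∑ n ∈ Finset.Ico T t, (A + G * ρ ^ n) :=
          Finset.sum_le_sum fun n _ => hp n
      _ = ((t - T : ℕ) : ℝ) * A + G * ∑ n ∈ Finset.Ico T t, ρ ^ n := by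
          simp [Finset.sum_add_distrib, Finset.mul_sum]
      _ ≤ t * A + G * (ρ ^ T / (1 - ρ)) := by
          gcongr
          · exact Nat.sub_le t T
          · exact geom_sum_Ico_le_of_lt_one hρ0 hρ1
  rw [← Finset.sum_range_add_sum_Ico _ hT.le]
  calc (1 / (t : ℝ)) * (∑ n ∈ Finset.range T, p n + ∑ n ∈ Finset.Ico T t, p n)
      ≤ (1 / (t : ℝ)) * (T + (t * A + G * (ρ ^ T / (1 - ρ)))) := by gcongr
    _ = A + (T : ℝ) / t + G * ρ ^ T / (t * (1 - ρ)) := by field_simp; ring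


open MeasureTheory

/-- Let `Z(t)` have `Z(0) = z₀` a.s., increments bounded by `δmax`, and
conditional drift at most `−β` (given the past) on the event `{Z(t) > 0}`, where
`0 < β ≤ δmax`.  With `r = β/(δmax² + δmax β/3)` and `ρ = 1 − rβ/2`, for any real `c > 0`
and integers `0 ≤ T < t`:
`(1/t) Σ_{τ=0}^{t−1} P[Z(τ) > c]
  ≤ (e^{r δmax} − ρ) e^{−rc}/(1 − ρ) + T/t + e^{r(z₀ − c)} ρ^T / (t(1 − ρ))`. -/
theorem stmt7 {Ωs : Type*} [MeasurableSpace Ωs] (P : Measure Ωs) [IsProbabilityMeasure P]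
    (Z : ℕ → Ωs → ℝ) (z0 δmax β r ρ : ℝ)
    (hmeas : ∀ t, Measurable (Z t))
    (hZ0 : ∀ᵐ x ∂P, Z 0 x = z0)
    (hδ : 0 < δmax) (hβ : 0 < β) (hβδ : β ≤ δmax)
    (hbdd : ∀ t : ℕ, ∀ᵐ x ∂P, |Z (t + 1) x - Z t x| ≤ δmax)
    (hdrift : ∀ t : ℕ, ∀ᵐ x ∂P, 0 < Z t x →
      (P[fun y => Z (t + 1) y - Z t y |
        ⨆ i ∈ Finset.range (t + 1), MeasurableSpace.comap (Z i) inferInstance]) x ≤ -β)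
    (hr : r = β / (δmax ^ 2 + δmax * β / 3)) (hρ : ρ = 1 - r * β / 2) :
    ∀ c : ℝ, 0 < c → ∀ T t : ℕ, T < t →
      (1 / (t : ℝ)) * ∑ τ ∈ Finset.range t, (P {x | c < Z τ x}).toReal ≤
        (Real.exp (r * δmax) - ρ) * Real.exp (-(r * c)) / (1 - ρ) + (T : ℝ) / t +
          Real.exp (r * (z0 - c)) * ρ ^ T / (t * (1 - ρ)) := by
  intro c _ T t hT
  have hden : 0 < δmax ^ 2 + δmax * β / 3 := by positivity
  have hr0 : 0 < r := hr ▸ div_pos hβ hden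
  have hrden : r * (δmax ^ 2 + δmax * β / 3) = β := by rw [hr]; field_simp
  have hrδ : r * δmax ≤ 1 := by
    rw [hr, div_mul_eq_mul_div, div_le_one hden]
    nlinarith [mul_pos hβ hδ]
  have hrβ : r * β ≤ 1 := (mul_le_mul_of_nonneg_left hβδ hr0.le).trans hrδ
  have hrβ0 : 0 < r * β := mul_pos hr0 hβ
  have hρ0 : 0 ≤ ρ := by linarith
  have hρ1 : ρ < 1 := by linarith
  have h1ρ : 0 < 1 - ρ := by linarith
  have hexp : ∀ d, |d| ≤ δmax → Real.exp (r * d) ≤ 1 + r * d + r * β / 2 := by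
    intro d hd
    refine exp_le_one_add_add_of_abs_le (y := r * δmax) ?_ hrδ ?_
    · rw [abs_mul, abs_of_pos hr0]
      exact mul_le_mul_of_nonneg_left hd hr0.le
    · linear_combination (-r / 2) * hrden
  have hZle : ∀ n : ℕ, ∀ᵐ x ∂P, Z n x ≤ z0 + n * δmax := by
    intro n
    induction n with
    | zero => filter_upwards [hZ0] with x hx; simp [hx]
    | succ n ih =>
      filter_upwards [ih, hbdd n] with x hx hd
      push_cast
      linarith [(abs_le.1 hd).2]
  have hint : ∀ n : ℕ, Integrable (fun x => Real.exp (r * Z n x)) P := by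
    intro n
    refine Integrable.of_bound
      (Real.measurable_exp.comp ((hmeas n).const_mul r)).aestronglyMeasurable
      (Real.exp (r * (z0 + n * δmax))) ?_
    filter_upwards [hZle n] with x hx
    rw [Real.norm_eq_abs, Real.abs_exp, Real.exp_le_exp]
    exact mul_le_mul_of_nonneg_left hx hr0.le
  have hδ1 : 1 ≤ Real.exp (r * δmax) := Real.one_le_exp (mul_pos hr0 hδ).le
  have hK : 0 ≤ Real.exp (r * δmax) - ρ := by linarith
  have hstep : ∀ n : ℕ, ∫ x, Real.exp (r * Z (n + 1) x) ∂P ≤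
      ρ * ∫ x, Real.exp (r * Z n x) ∂P + (Real.exp (r * δmax) - ρ) := by
    intro n
    rw [hρ]
    refine integral_exp_succ_le
      (m := ⨆ i ∈ Finset.range (n + 1), MeasurableSpace.comap (Z i) inferInstance)
      (iSup₂_le fun i _ => (hmeas i).comap_le) P ?_ (hmeas (n + 1)) hr0.le
      (hint n) (hint (n + 1)) (hbdd n) (hdrift n) hexp hδ.le
    exact (comap_measurable (Z n)).mono
      (le_iSup₂_of_le n (Finset.self_mem_range_succ n) le_rfl) le_rfl
  have hV0 : ∫ x, Real.exp (r * Z 0 x) ∂P = Real.exp (r * z0) := by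
    rw [integral_congr_ae (g := fun _ => Real.exp (r * z0))
      (by filter_upwards [hZ0] with x hx; rw [hx])]
    simp
  have hV := le_of_affine_contraction (V := fun n => ∫ x, Real.exp (r * Z n x) ∂P)
    hρ0 hρ1 hK hstep
  refine average_le_of_le_geometric (p := fun n => (P {x | c < Z n x}).toReal)
    (div_nonneg (mul_nonneg hK (Real.exp_pos _).le) h1ρ.le) (Real.exp_pos _).le hρ0 hρ1
    (fun n => measureReal_le_one) (fun n => ?_) hT
  have hchernoff : (P {x | c < Z n x}).toReal ≤
      Real.exp (-(r * c)) * ∫ x, Real.exp (r * Z n x) ∂P := by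
    have h := ProbabilityTheory.measure_ge_le_exp_mul_mgf c hr0.le (hint n)
    rw [ProbabilityTheory.mgf, neg_mul] at h
    have hsub : {x | c < Z n x} ⊆ {x | c ≤ Z n x} := fun x (hx : c < Z n x) => hx.le
    exact (measureReal_mono (μ := P) hsub).trans h
  refine hchernoff.trans
    ((mul_le_mul_of_nonneg_left (hV n) (Real.exp_pos (-(r * c))).le).trans_eq ?_)
  have hsplit : Real.exp (r * (z0 - c)) = Real.exp (-(r * c)) * Real.exp (r * z0) := by
    rw [← Real.exp_add]; ring_nf
  simp only [hV0]
  rw [hsplit]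
  ring
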